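/- arXiv:2511.00435 — 2 statements merged into one kernel-verified Lean document; each statement's English description precedes it below -/
import Mathlib

section
/- Let a : [0,∞) → ℝ be differentiable, nonincreasing, and bounded below, and let ψ : [0,∞) → [0,∞) be any function. Assume that for every c > 0 there exist constants r = r(c) > 0 and η = η(c) > 0 such that whenever t₁ ≥ 0 satisfies ψ(t₁) ≥ c, one has a′(t) ≤ −η for all t ∈ [t₁ − r, t₁ + r] ∩ [0,∞). Then ψ(t) → 0 as t → ∞. -/
open Filter

/-- Abstract mechanism behind Lemma 3.4: if `a` is differentiable, nonincreasing and
bounded below on `[0,∞)`, and whenever `ψ(t₁) ≥ c` the derivative `a'` is at most `-η(c)`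
on the whole neighborhood `[t₁ - r(c), t₁ + r(c)] ∩ [0,∞)`, then `ψ(t) → 0` as `t → ∞`. -/
theorem psi_tendsto_zero_of_area_decay
    (a a' : ℝ → ℝ) (ψ : ℝ → ℝ)
    (hderiv : ∀ t ∈ Set.Ici (0:ℝ), HasDerivWithinAt a (a' t) (Set.Ici 0) t)
    (hmono : AntitoneOn a (Set.Ici 0))
    (hbdd : ∃ m : ℝ, ∀ t ∈ Set.Ici (0:ℝ), m ≤ a t)
    (hψ : ∀ t ∈ Set.Ici (0:ℝ), 0 ≤ ψ t)
    (hkey : ∀ c > (0:ℝ), ∃ r > (0:ℝ), ∃ η > (0:ℝ), ∀ t₁ ∈ Set.Ici (0:ℝ), c ≤ ψ t₁ →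
      ∀ t ∈ Set.Icc (t₁ - r) (t₁ + r) ∩ Set.Ici (0:ℝ), a' t ≤ -η) :
    Tendsto ψ atTop (nhds 0) := by
  rw [Metric.tendsto_atTop]
  intro c hc
  obtain ⟨r, hr, η, hη, h⟩ := hkey c hc
  obtain ⟨m, hm⟩ := hbdd
  have hne : (a '' Set.Ici (0:ℝ)).Nonempty := ⟨a 0, 0, Set.mem_Ici.2 le_rfl, rfl⟩
  have hbb : BddBelow (a '' Set.Ici (0:ℝ)) := by
    refine ⟨m, ?_⟩
    rintro _ ⟨t, ht, rfl⟩
    exact hm t ht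
  have hpos : 0 < η * r := mul_pos hη hr
  obtain ⟨_, ⟨T, hT, rfl⟩, hlt⟩ := exists_lt_of_csInf_lt hne
    (lt_add_of_pos_right (sInf (a '' Set.Ici (0:ℝ))) hpos)
  have hT0 : 0 ≤ T := hT
  refine ⟨T, fun t ht => ?_⟩
  have ht0 : 0 ≤ t := le_trans hT0 ht
  rw [Real.dist_eq, sub_zero, abs_of_nonneg (hψ t ht0)]
  by_contra hcon
  have hcon' : c ≤ ψ t := not_lt.1 hcon
  obtain ⟨x, hx, hxs⟩ := exists_hasDerivAt_eq_slope a a' (show t < t + r by linarith)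
    (fun y hy => ((hderiv y (le_trans ht0 hy.1)).continuousWithinAt).mono
      (fun z hz => le_trans ht0 hz.1))
    (fun y hy => (hderiv y (le_trans ht0 hy.1.le)).hasDerivAt
      (Ici_mem_nhds (lt_of_le_of_lt ht0 hy.1)))
  have hle := h t ht0 hcon' x ⟨⟨by linarith [hx.1], hx.2.le⟩, le_trans ht0 hx.1.le⟩
  rw [hxs, add_sub_cancel_left, div_le_iff₀ hr] at hle
  have h1 : a t ≤ a T := hmono hT ht0 ht
  have h2 : sInf (a '' Set.Ici (0:ℝ)) ≤ a (t + r) :=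
    csInf_le hbb ⟨t + r, Set.mem_Ici.2 (by linarith), rfl⟩
  linarith
end

section
/- For β > 0 and n ≥ 2, define u₂ : ℝ² → ℝ by u₂(x₁, x₂) = (x₁ + x₂)/2 + √(((x₁ − x₂)/2)² + β²), and recursively for n ≥ 3 define u_n : ℝⁿ → ℝ by u_n(x₁, …, x_n) = (1/n)·Σ_{i=1}^{n} u₂(x_i, u_{n−1}(x₁, …, x̂_i, …, x_n)), where x̂_i means that the i-th variable is omitted. Then for all x ∈ ℝⁿ, max_{1≤i≤n} x_i ≤ u_n(x₁, …, x_n) ≤ max_{1≤i≤n} x_i + (n − 1)β. In particular, as β → 0 the functions u_n converge uniformly on ℝⁿ to the function x ↦ max_{1≤i≤n} x_i. -/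
/-- The two-variable smoothed maximum `u₂(a,b) = (a+b)/2 + √(((a-b)/2)² + β²)`. -/
noncomputable def smoothMax2 (β a b : ℝ) : ℝ :=
  (a + b)/2 + Real.sqrt (((a - b)/2)^2 + β^2)

/-- The recursively defined smoothed maximum of `k+2` real numbers:
`u_n(x₁,…,x_n) = (1/n) Σᵢ u₂(xᵢ, u_{n-1}(x₁,…,x̂ᵢ,…,x_n))` for `n = k+2 ≥ 3`, with base
case `u₂` for `n = 2` (i.e. `k = 0`). -/
noncomputable def smoothMaxRec (β : ℝ) : (k : ℕ) → (Fin (k+2) → ℝ) → ℝ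
  | 0, x => smoothMax2 β (x 0) (x 1)
  | (k+1), x =>
      (1/((k:ℝ)+3)) *
        ∑ i : Fin (k+3), smoothMax2 β (x i) (smoothMaxRec β k (fun j => x (i.succAbove j)))

theorem smoothMax2_left {β a b : ℝ} : a ≤ smoothMax2 β a b := by
  unfold smoothMax2
  have : (a - b)/2 ≤ Real.sqrt (((a - b)/2)^2 + β^2) :=
    Real.le_sqrt_of_sq_le (by nlinarith [sq_nonneg β])
  linarith

theorem smoothMax2_right {β a b : ℝ} : b ≤ smoothMax2 β a b := by
  unfold smoothMax2
  have : (b - a)/2 ≤ Real.sqrt (((a - b)/2)^2 + β^2) :=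
    Real.le_sqrt_of_sq_le (by nlinarith [sq_nonneg β])
  linarith

theorem smoothMax2_upper {β a b M : ℝ} (hβ : 0 < β) (ha : a ≤ M) (hb : b ≤ M) :
    smoothMax2 β a b ≤ M + β := by
  unfold smoothMax2
  have h : Real.sqrt (((a - b)/2)^2 + β^2) ≤ |(a - b)/2| + β := by
    apply Real.sqrt_le_iff.2
    refine ⟨by positivity, ?_⟩
    nlinarith [sq_abs ((a - b)/2), mul_nonneg (abs_nonneg ((a - b)/2)) hβ.le]
  rcases abs_cases ((a - b)/2) with h' | h' <;> linarith

theorem smoothMaxRec_core {β : ℝ} (hβ : 0 < β) (k : ℕ) : ∀ x : Fin (k+2) → ℝ,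
    (∀ i, x i ≤ smoothMaxRec β k x) ∧
    ∀ M, (∀ i, x i ≤ M) → smoothMaxRec β k x ≤ M + ((k:ℝ)+1) * β := by
  induction k with
  | zero =>
    intro x
    simp only [smoothMaxRec]
    refine ⟨fun i => ?_, fun M hM => ?_⟩
    · fin_cases i
      · exact smoothMax2_left
      · exact smoothMax2_right
    · have := smoothMax2_upper hβ (hM 0) (hM 1)
      simpa using this
  | succ k ih =>
    intro x
    have hk : (0:ℝ) < (k:ℝ) + 3 := by positivity
    simp only [smoothMaxRec]
    refine ⟨fun i => ?_, fun M hM => ?_⟩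
    · rw [one_div, inv_mul_eq_div, le_div_iff₀ hk]
      have h := Finset.card_nsmul_le_sum (Finset.univ : Finset (Fin (k+3)))
        (fun j => smoothMax2 β (x j) (smoothMaxRec β k (fun l => x (j.succAbove l)))) (x i) ?_
      · simp only [Finset.card_univ, Fintype.card_fin, nsmul_eq_mul] at h
        push_cast at h
        linarith
      · intro j _
        by_cases hij : i = j
        · subst hij
          exact smoothMax2_left
        · obtain ⟨l, rfl⟩ := Fin.exists_succAbove_eq hij
          exact ((ih (fun l => x (j.succAbove l))).1 l).trans smoothMax2_right
    · rw [one_div, inv_mul_eq_div, div_le_iff₀ hk]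
      have h := Finset.sum_le_card_nsmul (Finset.univ : Finset (Fin (k+3)))
        (fun j => smoothMax2 β (x j) (smoothMaxRec β k (fun l => x (j.succAbove l))))
        (M + ((k:ℝ)+1) * β + β) ?_
      · simp only [Finset.card_univ, Fintype.card_fin, nsmul_eq_mul] at h
        push_cast at h ⊢
        linarith
      · intro j _
        apply smoothMax2_upper hβ
        · have : 0 ≤ ((k:ℝ)+1) * β := by positivity
          linarith [hM j]
        · exact (ih _).2 M (fun l => hM _)

/-- For `β > 0` and `n = k+2` variables, the recursively smoothed maximum satisfies
`max_i x_i ≤ u_n(x) ≤ max_i x_i + (n-1)β`; in particular, as `β → 0⁺` the functions `u_n`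
converge uniformly on `ℝⁿ` to `x ↦ max_i x_i`. -/
theorem smoothMaxRec_bounds (k : ℕ) :
    (∀ β : ℝ, 0 < β → ∀ x : Fin (k+2) → ℝ,
      Finset.univ.sup' Finset.univ_nonempty x ≤ smoothMaxRec β k x ∧
      smoothMaxRec β k x ≤ Finset.univ.sup' Finset.univ_nonempty x + ((k:ℝ)+1) * β) ∧
    TendstoUniformly (fun (β : ℝ) (x : Fin (k+2) → ℝ) => smoothMaxRec β k x)
      (fun x => Finset.univ.sup' Finset.univ_nonempty x)
      (nhdsWithin 0 (Set.Ioi 0)) := by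
  have key : ∀ β : ℝ, 0 < β → ∀ x : Fin (k+2) → ℝ,
      Finset.univ.sup' Finset.univ_nonempty x ≤ smoothMaxRec β k x ∧
      smoothMaxRec β k x ≤ Finset.univ.sup' Finset.univ_nonempty x + ((k:ℝ)+1) * β := by
    intro β hβ x
    have h := smoothMaxRec_core hβ k x
    exact ⟨Finset.sup'_le _ _ (fun i _ => h.1 i),
      h.2 _ (fun i => Finset.le_sup' x (Finset.mem_univ i))⟩
  refine ⟨key, ?_⟩
  rw [Metric.tendstoUniformly_iff]
  intro ε hε
  have hk : (0:ℝ) < (k:ℝ) + 1 := by positivity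
  have hm : Set.Ioo (0:ℝ) (ε / ((k:ℝ)+1)) ∈ nhdsWithin (0:ℝ) (Set.Ioi 0) :=
    Ioo_mem_nhdsGT (by positivity)
  filter_upwards [hm] with β hβ x
  obtain ⟨h1, h2⟩ := key β hβ.1 x
  have h3 := (lt_div_iff₀ hk).1 hβ.2
  rw [Real.dist_eq, abs_lt]
  constructor <;> linarith
end
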